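/- Let A and B be rings and let M be a B-A-bimodule that is finitely generated projective as a left B-module and as a right A-module, and such that Hom_B(M, B) and Hom_{A^op}(M, A) are isomorphic as A-B-bimodules (i.e. M is a Frobenius bimodule). If X is a Gorenstein projective left A-module, then M ⊗_A X is a Gorenstein projective left B-module. If moreover M is a generator as a right A-module, then conversely a left A-module X is Gorenstein projective whenever M ⊗_A X is a Gorenstein projective left B-module. -/

import Mathlib

open CategoryTheory CategoryTheory.Limits

section GorensteinPrelude

variable {C : Type*} [Category C] [Abelian C]

/-- A totally acyclic complex of projective objects, encoded by its objects `P n` and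
differentials `d n : P n ⟶ P (n + 1)`: each `P n` is projective, consecutive differentials
compose to zero, the complex is acyclic (exact at each spot), and it stays exact after
applying `Hom(-, Q)` for every projective object `Q`. -/
structure IsTotallyAcyclic (P : ℤ → C) (d : ∀ n : ℤ, P n ⟶ P (n + 1)) : Prop where
  projective : ∀ n, Projective (P n)
  comp_eq_zero : ∀ n, d n ≫ d (n + 1) = 0
  exact : ∀ n, (ShortComplex.mk (d n) (d (n + 1)) (comp_eq_zero n)).Exact
  hom_exact : ∀ (Q : C), Projective Q → ∀ n,
    Function.Exact (fun g : P (n + 1 + 1) ⟶ Q => d (n + 1) ≫ g)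
      (fun g : P (n + 1) ⟶ Q => d n ≫ g)

/-- An object is Gorenstein projective if it is isomorphic to a cycle object of some
totally acyclic complex of projective objects. -/
def IsGorensteinProjective (M : C) : Prop :=
  ∃ (P : ℤ → C) (d : ∀ n : ℤ, P n ⟶ P (n + 1)) (_ : IsTotallyAcyclic P d) (n : ℤ),
    Nonempty (M ≅ kernel (d n))

/-- `pdLE n X` : `X` admits a projective resolution of length at most `n`,
i.e. an exact sequence `0 → P_n → ⋯ → P_0 → X → 0` with every `P_i` projective. -/
def pdLE : ℕ → C → Prop
  | 0, X => Projective X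
  | (n + 1), X => ∃ (K P : C) (i : K ⟶ P) (p : P ⟶ X) (w : i ≫ p = 0),
      Projective P ∧ (ShortComplex.mk i p w).ShortExact ∧ pdLE n K

/-- `X` has finite projective dimension. -/
def HasFinitePd (X : C) : Prop := ∃ n, pdLE n X

/-- `gpdLE n X` : `X` admits a Gorenstein projective resolution of length at most `n`,
i.e. an exact sequence `0 → G_n → ⋯ → G_0 → X → 0` with every `G_i` Gorenstein projective. -/
def gpdLE : ℕ → C → Prop
  | 0, X => IsGorensteinProjective X
  | (n + 1), X => ∃ (K G : C) (i : K ⟶ G) (p : G ⟶ X) (w : i ≫ p = 0),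
      IsGorensteinProjective G ∧ (ShortComplex.mk i p w).ShortExact ∧ gpdLE n K

/-- `X` has finite Gorenstein projective dimension. -/
def HasFiniteGpd (X : C) : Prop := ∃ n, gpdLE n X

/-- A morphism factors through a projective object. -/
def FactorsThroughProjective {X Y : C} (f : X ⟶ Y) : Prop :=
  ∃ (P : C) (_ : Projective P) (a : X ⟶ P) (b : P ⟶ Y), f = a ≫ b

/-- Two parallel morphisms become equal in the stable category, i.e. their difference
factors through a projective object. -/
def StablyEqual {X Y : C} (f g : X ⟶ Y) : Prop := FactorsThroughProjective (f - g)

/-- A morphism is a stable isomorphism if it becomes invertible in the stable category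
(morphisms modulo those factoring through a projective object). -/
def IsStableIso {X Y : C} (f : X ⟶ Y) : Prop :=
  ∃ g : Y ⟶ X, StablyEqual (f ≫ g) (𝟙 X) ∧ StablyEqual (g ≫ f) (𝟙 Y)

end GorensteinPrelude

section HomExactSyzygy

variable {C : Type*} [Category C]

/-- Every morphism from `X` to a projective object extends along `i : X ⟶ Z`. -/
def ExtendsToProjectives {X Z : C} (i : X ⟶ Z) : Prop :=
  ∀ (T : C), Projective T → ∀ f : X ⟶ T, ∃ g : Z ⟶ T, i ≫ g = f

lemma ExtendsToProjectives.comp {X Y Z : C} {i : X ⟶ Y} {j : Y ⟶ Z}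
    (hi : ExtendsToProjectives i) (hj : ExtendsToProjectives j) :
    ExtendsToProjectives (i ≫ j) := by
  intro T hT f
  obtain ⟨g, rfl⟩ := hi T hT f
  obtain ⟨k, rfl⟩ := hj T hT g
  exact ⟨k, by simp⟩

lemma ExtendsToProjectives.of_comp {X Y Z : C} {i : X ⟶ Y} {j : Y ⟶ Z}
    (h : ExtendsToProjectives (i ≫ j)) : ExtendsToProjectives i := by
  intro T hT f
  obtain ⟨g, rfl⟩ := h T hT f
  exact ⟨j ≫ g, by simp⟩

lemma ExtendsToProjectives.of_splitMono {X Z : C} (i : X ⟶ Z) [IsSplitMono i] :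
    ExtendsToProjectives i :=
  fun _ _ f => ⟨retraction i ≫ f, by simp⟩

variable [Abelian C]

/-- There is a short exact sequence `0 ⟶ X ⟶ P ⟶ Y ⟶ 0` with `P` projective which stays exact
after applying `Hom(-, T)` for every projective `T`. -/
def IsHomExactSyzygy (X Y : C) : Prop :=
  ∃ (P : C) (i : X ⟶ P) (p : P ⟶ Y) (w : i ≫ p = 0),
    Projective P ∧ (ShortComplex.mk i p w).ShortExact ∧ ExtendsToProjectives i

lemma CategoryTheory.ShortComplex.shortExact_of_exists_lift {X P Y : C} {i : X ⟶ P} {p : P ⟶ Y} (w : i ≫ p = 0)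
    [Mono i] [Epi p] (h : ∀ {A : C} (k : A ⟶ P), k ≫ p = 0 → ∃ l : A ⟶ X, l ≫ i = k) :
    (ShortComplex.mk i p w).ShortExact where
  exact := ShortComplex.exact_of_f_is_kernel _
    (KernelFork.IsLimit.ofι' _ _ fun k hk => ⟨(h k hk).choose, (h k hk).choose_spec⟩)
  mono_f := inferInstance
  epi_g := inferInstance

lemma CategoryTheory.ShortComplex.shortExact_of_exists_desc {X P Y : C} {i : X ⟶ P} {p : P ⟶ Y} (w : i ≫ p = 0)
    [Mono i] [Epi p] (h : ∀ {A : C} (k : P ⟶ A), i ≫ k = 0 → ∃ l : Y ⟶ A, p ≫ l = k) :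
    (ShortComplex.mk i p w).ShortExact where
  exact := ShortComplex.exact_of_g_is_cokernel _
    (CokernelCofork.IsColimit.ofπ' _ _ fun k hk => ⟨(h k hk).choose, (h k hk).choose_spec⟩)
  mono_f := inferInstance
  epi_g := inferInstance

lemma CategoryTheory.ShortComplex.ShortExact.exists_lift {X P Y : C} {i : X ⟶ P} {p : P ⟶ Y} {w : i ≫ p = 0}
    (h : (ShortComplex.mk i p w).ShortExact) {A : C} (k : A ⟶ P) (hk : k ≫ p = 0) :
    ∃ l : A ⟶ X, l ≫ i = k :=
  have := h.mono_f
  ⟨h.exact.lift k hk, h.exact.lift_f k hk⟩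

lemma CategoryTheory.ShortComplex.ShortExact.exists_desc {X P Y : C} {i : X ⟶ P} {p : P ⟶ Y} {w : i ≫ p = 0}
    (h : (ShortComplex.mk i p w).ShortExact) {A : C} (k : P ⟶ A) (hk : i ≫ k = 0) :
    ∃ l : Y ⟶ A, p ≫ l = k :=
  have := h.epi_g
  ⟨h.exact.desc k hk, h.exact.g_desc k hk⟩

lemma CategoryTheory.ShortComplex.ShortExact.biprod_right {X P Y : C} {i : X ⟶ P} {p : P ⟶ Y} {w : i ≫ p = 0}
    (h : (ShortComplex.mk i p w).ShortExact) (Q : C) :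
    (ShortComplex.mk (i ≫ biprod.inl) (biprod.map p (𝟙 Q))
      (by simp [reassoc_of% w])).ShortExact := by
  have : Mono i := h.mono_f
  have : Epi p := h.epi_g
  refine ShortComplex.shortExact_of_exists_lift _ fun k hk => ?_
  obtain ⟨l, hl⟩ := h.exists_lift (k ≫ biprod.fst) (by simpa using hk =≫ biprod.fst)
  refine ⟨l, ?_⟩
  have h2 : k ≫ biprod.snd = 0 := by simpa using hk =≫ biprod.snd
  ext <;> simp [hl, h2]

lemma CategoryTheory.ShortComplex.ShortExact.biprod_left {X P Y : C} {i : X ⟶ P} {p : P ⟶ Y} {w : i ≫ p = 0}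
    (h : (ShortComplex.mk i p w).ShortExact) (Q : C) :
    (ShortComplex.mk (biprod.map i (𝟙 Q)) (biprod.fst ≫ p) (by simp [w])).ShortExact := by
  have : Mono i := h.mono_f
  have : Epi p := h.epi_g
  refine ShortComplex.shortExact_of_exists_lift _ fun k hk => ?_
  obtain ⟨l, hl⟩ := h.exists_lift (k ≫ biprod.fst) (by simpa using hk)
  refine ⟨biprod.lift l (k ≫ biprod.snd), ?_⟩
  ext <;> simp [hl]

lemma ExtendsToProjectives.biprod_map_id {X P : C} {i : X ⟶ P} (h : ExtendsToProjectives i)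
    (Q : C) : ExtendsToProjectives (biprod.map i (𝟙 Q)) := by
  intro T hT f
  obtain ⟨g, hg⟩ := h T hT (biprod.inl ≫ f)
  exact ⟨biprod.desc g (biprod.inr ≫ f), by ext <;> simp [hg]⟩

namespace IsHomExactSyzygy

lemma biprod_right {X Y : C} (h : IsHomExactSyzygy X Y) (Q : C) (hQ : Projective Q) :
    IsHomExactSyzygy X (Y ⊞ Q) := by
  obtain ⟨P, i, p, w, hP, hs, he⟩ := h
  exact ⟨P ⊞ Q, _, _, _, inferInstance, hs.biprod_right Q, he.comp (.of_splitMono _)⟩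

lemma biprod_left {X Y : C} (h : IsHomExactSyzygy X Y) (Q : C) (hQ : Projective Q) :
    IsHomExactSyzygy (X ⊞ Q) Y := by
  obtain ⟨P, i, p, w, hP, hs, he⟩ := h
  exact ⟨P ⊞ Q, _, _, _, inferInstance, hs.biprod_left Q, he.biprod_map_id Q⟩

lemma of_iso {X X' Y Y' : C} (h : IsHomExactSyzygy X Y) (e : X ≅ X') (e' : Y ≅ Y') :
    IsHomExactSyzygy X' Y' := by
  obtain ⟨P, i, p, w, hP, hs, he⟩ := h
  refine ⟨P, e.inv ≫ i, p ≫ e'.hom, by simp [reassoc_of% w], hP, ?_,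
    (ExtendsToProjectives.of_splitMono _).comp he⟩
  let φ : ShortComplex.mk i p w ≅
      ShortComplex.mk (e.inv ≫ i) (p ≫ e'.hom) (by simp [reassoc_of% w]) :=
    ShortComplex.isoMk e (Iso.refl _) e'
  exact ShortComplex.shortExact_of_iso φ hs

/-- If `Y` has a syzygy in the sense of `IsHomExactSyzygy`, then `Ext¹(Y, T)` vanishes for
projective `T`, so every short exact sequence ending in `Y` stays exact after `Hom(-, T)`. -/
lemma extendsToProjectives {K Y : C} (h : IsHomExactSyzygy K Y) {X Z : C} {i : X ⟶ Z}
    {p : Z ⟶ Y} {w : i ≫ p = 0} (hs : (ShortComplex.mk i p w).ShortExact) :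
    ExtendsToProjectives i := by
  obtain ⟨P, i', p', w', hP, hs', he⟩ := h
  have := HasExt.standard C
  intro T hT f
  obtain ⟨x, hx⟩ := Abelian.Ext.contravariant_sequence_exact₃ hs' T
    (hs.extClass.comp (Abelian.Ext.mk₀ f) (add_zero 1))
    (Abelian.Ext.eq_zero_of_projective _) (add_zero 1)
  obtain ⟨x, rfl⟩ := Abelian.Ext.addEquiv₀.symm.surjective x
  obtain ⟨g, rfl⟩ := he T hT x
  obtain ⟨y, hy⟩ := Abelian.Ext.contravariant_sequence_exact₁ hs T (Abelian.Ext.mk₀ f)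
    (add_zero 1) (by
      rw [← hx, Abelian.Ext.addEquiv₀_symm_apply, ← Abelian.Ext.mk₀_comp_mk₀]
      exact hs'.extClass_comp_assoc _)
  obtain ⟨y, rfl⟩ := Abelian.Ext.addEquiv₀.symm.surjective y
  refine ⟨y, Abelian.Ext.addEquiv₀.symm.injective ?_⟩
  simpa using hy

end IsHomExactSyzygy

/-- For two short exact sequences with the same right term, the pullback of the middle terms is
an extension of one middle term by the other left term. -/
lemma CategoryTheory.ShortComplex.ShortExact.shortExact_pullback {P Y X' P' : C} (p : P ⟶ Y)
    {i' : X' ⟶ P'} {p' : P' ⟶ Y} {w' : i' ≫ p' = 0}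
    (h' : (ShortComplex.mk i' p' w').ShortExact) :
    (ShortComplex.mk (pullback.lift 0 i' (by simp [w'])) (pullback.fst p p')
      (pullback.lift_fst _ _ _)).ShortExact := by
  have : Mono i' := h'.mono_f
  have : Epi p' := h'.epi_g
  have : Mono (pullback.lift 0 i' (by simp [w']) : X' ⟶ pullback p p') :=
    mono_of_mono_fac (pullback.lift_snd _ _ _)
  refine ShortComplex.shortExact_of_exists_lift _ fun k hk => ?_
  obtain ⟨l, hl⟩ := h'.exists_lift (k ≫ pullback.snd p p') (by
    rw [Category.assoc, ← pullback.condition, reassoc_of% hk, zero_comp])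
  refine ⟨l, pullback.hom_ext ?_ ?_⟩
  · rw [Category.assoc, pullback.lift_fst, hk, comp_zero]
  · rw [Category.assoc, pullback.lift_snd, hl]

/-- For two short exact sequences with the same left term, the pushout of the middle terms is
an extension of one right term by the other middle term. -/
lemma CategoryTheory.ShortComplex.ShortExact.shortExact_pushout {X P P' Y' : C} (i : X ⟶ P)
    {i' : X ⟶ P'} {p' : P' ⟶ Y'} {w' : i' ≫ p' = 0}
    (h' : (ShortComplex.mk i' p' w').ShortExact) :
    (ShortComplex.mk (pushout.inl i i') (pushout.desc 0 p' (by simp [w']))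
      (pushout.inl_desc _ _ _)).ShortExact := by
  have : Mono i' := h'.mono_f
  have : Epi p' := h'.epi_g
  have : Epi (pushout.desc 0 p' (by simp [w']) : pushout i i' ⟶ Y') :=
    epi_of_epi_fac (pushout.inr_desc _ _ _)
  refine ShortComplex.shortExact_of_exists_desc _ fun k hk => ?_
  obtain ⟨l, hl⟩ := h'.exists_desc (pushout.inr i i' ≫ k) (by
    rw [← Category.assoc, ← pushout.condition, Category.assoc, hk, comp_zero])
  refine ⟨l, pushout.hom_ext ?_ ?_⟩
  · rw [pushout.inl_desc_assoc, hk, zero_comp]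
  · rw [pushout.inr_desc_assoc, hl]

lemma CategoryTheory.ShortComplex.ShortExact.nonempty_iso_of_projective {X P Y : C} {i : X ⟶ P}
    {p : P ⟶ Y} {w : i ≫ p = 0} (h : (ShortComplex.mk i p w).ShortExact) (hY : Projective Y) :
    Nonempty (P ≅ X ⊞ Y) := by
  have : Epi p := h.epi_g
  exact ⟨(ShortComplex.Splitting.ofExactOfSection _ h.exact (Projective.factorThru (𝟙 Y) p)
    (by simp) h.mono_f).isoBinaryBiproduct⟩

lemma CategoryTheory.ShortComplex.ShortExact.nonempty_iso_of_retraction {X P Y : C} {i : X ⟶ P}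
    {p : P ⟶ Y} {w : i ≫ p = 0} (h : (ShortComplex.mk i p w).ShortExact) (r : P ⟶ X)
    (hr : i ≫ r = 𝟙 X) : Nonempty (P ≅ X ⊞ Y) :=
  ⟨(ShortComplex.Splitting.ofExactOfRetraction _ h.exact r hr h.epi_g).isoBinaryBiproduct⟩

/-- Schanuel's lemma. -/
lemma CategoryTheory.ShortComplex.ShortExact.schanuel {X P Y X' P' : C}
    {i : X ⟶ P} {p : P ⟶ Y} {w : i ≫ p = 0} (h : (ShortComplex.mk i p w).ShortExact)
    {i' : X' ⟶ P'} {p' : P' ⟶ Y} {w' : i' ≫ p' = 0}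
    (h' : (ShortComplex.mk i' p' w').ShortExact) (hP : Projective P) (hP' : Projective P') :
    Nonempty (X ⊞ P' ≅ X' ⊞ P) := by
  obtain ⟨e⟩ := (h'.shortExact_pullback p).nonempty_iso_of_projective hP
  obtain ⟨e'⟩ := (h.shortExact_pullback p').nonempty_iso_of_projective hP'
  exact ⟨e'.symm ≪≫ pullbackSymmetry _ _ ≪≫ e⟩

lemma ExtendsToProjectives.exists_retraction_pushout {X P P' : C} (i : X ⟶ P) {i' : X ⟶ P'}
    (h : ExtendsToProjectives i') (hP : Projective P) :
    ∃ r, pushout.inl i i' ≫ r = 𝟙 P := by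
  obtain ⟨g, hg⟩ := h P hP i
  exact ⟨pushout.desc (𝟙 P) g (by simp [hg]), pushout.inl_desc _ _ _⟩

/-- The dual of Schanuel's lemma, for embeddings along which morphisms to projective objects
extend. -/
lemma CategoryTheory.ShortComplex.ShortExact.schanuel_of_extendsToProjectives {X P Y P' Y' : C}
    {i : X ⟶ P} {p : P ⟶ Y} {w : i ≫ p = 0} (h : (ShortComplex.mk i p w).ShortExact)
    {i' : X ⟶ P'} {p' : P' ⟶ Y'} {w' : i' ≫ p' = 0}
    (h' : (ShortComplex.mk i' p' w').ShortExact) (hP : Projective P) (hP' : Projective P')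
    (he : ExtendsToProjectives i) (he' : ExtendsToProjectives i') :
    Nonempty (Y ⊞ P' ≅ Y' ⊞ P) := by
  obtain ⟨r, hr⟩ := he'.exists_retraction_pushout i hP
  obtain ⟨r', hr'⟩ := he.exists_retraction_pushout i' hP'
  obtain ⟨e⟩ := (h'.shortExact_pushout i).nonempty_iso_of_retraction r hr
  obtain ⟨e'⟩ := (h.shortExact_pushout i').nonempty_iso_of_retraction r' hr'
  exact ⟨biprod.braiding _ _ ≪≫ e'.symm ≪≫ pushoutSymmetry _ _ ≪≫ e ≪≫ biprod.braiding _ _⟩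

end HomExactSyzygy

/-- A relation which is total in both directions admits a bi-infinite chain through every
element. -/
lemma exists_int_chain {α : Type*} (R : α → α → Prop) (succ : ∀ a, ∃ b, R a b)
    (pred : ∀ b, ∃ a, R a b) (a : α) : ∃ z : ℤ → α, z 0 = a ∧ ∀ n, R (z n) (z (n + 1)) := by
  choose s hs using succ
  choose p hp using pred
  refine ⟨fun n => match n with
    | .ofNat k => s^[k] a
    | .negSucc k => p^[k + 1] a, rfl, fun n => ?_⟩
  match n with
  | .ofNat k =>
    change R (s^[k] a) (s^[k + 1] a)
    rw [Function.iterate_succ_apply']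
    exact hs _
  | .negSucc 0 => exact hp a
  | .negSucc (k + 1) =>
    change R (p^[k + 1 + 1] a) (p^[k + 1] a)
    rw [Function.iterate_succ_apply' p (k + 1)]
    exact hp _

section GorensteinProjective

variable {C : Type*} [Category C] [Abelian C]

lemma isGorensteinProjective_of_int_chain (Z : ℤ → C)
    (h : ∀ n, IsHomExactSyzygy (Z n) (Z (n + 1))) : IsGorensteinProjective (Z 0) := by
  choose P i p w hP hs he using h
  have hi (n) : Mono (i n) := (hs n).mono_f
  have hp (n) : Epi (p n) := (hs n).epi_g
  refine ⟨P, fun n => p n ≫ i (n + 1), ⟨hP, fun n => by simp [reassoc_of% (w (n + 1))],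
    fun n => ?_, fun Q hQ n g => ⟨fun hg => ?_, ?_⟩⟩, 0, ⟨?_⟩⟩
  · rw [ShortComplex.exact_iff_exact_up_to_refinements]
    intro A k hk
    obtain ⟨l, hl⟩ := (hs (n + 1)).exists_lift k (by
      simpa [← cancel_mono (i (n + 1 + 1))] using hk)
    obtain ⟨A', π, hπ, l', hl'⟩ := surjective_up_to_refinements_of_epi (p n) l
    exact ⟨A', π, hπ, l', by simp [← hl, reassoc_of% hl']⟩
  · obtain ⟨g', hg'⟩ := (hs (n + 1)).exists_desc g (by
      simpa [← cancel_epi (p n)] using hg)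
    obtain ⟨k, hk⟩ := he (n + 1 + 1) Q hQ g'
    exact ⟨k, by simp [hk, hg']⟩
  · rintro ⟨k, rfl⟩
    simp [reassoc_of% (w (n + 1))]
  · have hw : i 0 ≫ p 0 ≫ i (0 + 1) = 0 := by simp [reassoc_of% (w 0)]
    exact IsLimit.conePointUniqueUpToIso
      (KernelFork.IsLimit.ofι' (i 0) hw fun k hk =>
        have hk' := (hs 0).exists_lift k (by
          simpa [← cancel_mono (i (0 + 1))] using hk)
        ⟨hk'.choose, hk'.choose_spec⟩)
      (limit.isLimit (parallelPair (p 0 ≫ i (0 + 1)) 0))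

/-- Coinduction principle: a class of objects, each of which has a syzygy and a cosyzygy in the
class, consists of Gorenstein projective objects. -/
lemma isGorensteinProjective_of_class (W : C → Prop)
    (hleft : ∀ Y, W Y → ∃ X, W X ∧ IsHomExactSyzygy X Y)
    (hright : ∀ X, W X → ∃ Y, W Y ∧ IsHomExactSyzygy X Y) {X : C} (hX : W X) :
    IsGorensteinProjective X := by
  obtain ⟨z, hz, h⟩ := exists_int_chain
    (fun a b : {Z : C // W Z} => IsHomExactSyzygy a.1 b.1)
    (fun a => have ⟨Y, hY, h⟩ := hright a.1 a.2; ⟨⟨Y, hY⟩, h⟩)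
    (fun b => have ⟨Y, hY, h⟩ := hleft b.1 b.2; ⟨⟨Y, hY⟩, h⟩) ⟨X, hX⟩
  simpa [hz] using isGorensteinProjective_of_int_chain (fun n => (z n).1) h

namespace IsTotallyAcyclic

variable {P : ℤ → C} {d : ∀ n : ℤ, P n ⟶ P (n + 1)}

lemma isHomExactSyzygy_kernel (h : IsTotallyAcyclic P d) (n : ℤ) :
    IsHomExactSyzygy (kernel (d n)) (kernel (d (n + 1))) := by
  obtain ⟨m, rfl⟩ : ∃ m, n = m + 1 + 1 := ⟨n - 2, by ring⟩
  have hepi (k) : Epi (kernel.lift (d (k + 1)) (d k) (h.comp_eq_zero k)) :=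
    (ShortComplex.exact_iff_epi_kernel_lift _).1 (h.exact k)
  have := hepi (m + 1)
  have := hepi (m + 1 + 1)
  refine ⟨_, kernel.ι _, kernel.lift _ (d (m + 1 + 1)) (h.comp_eq_zero _), ?_,
    h.projective _, ?_, ?_⟩
  · simp [← cancel_mono (kernel.ι _)]
  · refine ShortComplex.shortExact_of_exists_lift _ fun k hk => ⟨kernel.lift _ k ?_, kernel.lift_ι _ _ _⟩
    simpa using hk =≫ kernel.ι _
  · intro T hT f
    obtain ⟨g, hg⟩ := (h.hom_exact T hT m
      (kernel.lift (d (m + 1 + 1)) (d (m + 1)) (h.comp_eq_zero _) ≫ f)).1 (by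
        have : d m ≫ kernel.lift (d (m + 1 + 1)) (d (m + 1)) (h.comp_eq_zero _) = 0 := by
          simp [← cancel_mono (kernel.ι _), h.comp_eq_zero]
        simp [reassoc_of% this])
    refine ⟨g, ?_⟩
    rw [← cancel_epi (kernel.lift (d (m + 1 + 1)) (d (m + 1)) (h.comp_eq_zero _))]
    simpa using hg

end IsTotallyAcyclic

namespace IsGorensteinProjective

lemma of_iso {X Y : C} (h : IsGorensteinProjective X) (e : X ≅ Y) :
    IsGorensteinProjective Y := by
  obtain ⟨P, d, h, n, ⟨e'⟩⟩ := h
  exact ⟨P, d, h, n, ⟨e.symm ≪≫ e'⟩⟩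

lemma exists_syzygy {Y : C} (h : IsGorensteinProjective Y) :
    ∃ X, IsGorensteinProjective X ∧ IsHomExactSyzygy X Y := by
  obtain ⟨P, d, h, n, ⟨e⟩⟩ := h
  obtain ⟨m, rfl⟩ : ∃ m, n = m + 1 := ⟨n - 1, by ring⟩
  exact ⟨_, ⟨P, d, h, m, ⟨Iso.refl _⟩⟩, (h.isHomExactSyzygy_kernel m).of_iso (Iso.refl _) e.symm⟩

lemma exists_cosyzygy {X : C} (h : IsGorensteinProjective X) :
    ∃ Y, IsGorensteinProjective Y ∧ IsHomExactSyzygy X Y := by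
  obtain ⟨P, d, h, n, ⟨e⟩⟩ := h
  exact ⟨_, ⟨P, d, h, n + 1, ⟨Iso.refl _⟩⟩,
    (h.isHomExactSyzygy_kernel n).of_iso e.symm (Iso.refl _)⟩

lemma biprod {X : C} (h : IsGorensteinProjective X) (Q : C) (hQ : Projective Q) :
    IsGorensteinProjective (X ⊞ Q) := by
  refine isGorensteinProjective_of_class
    (fun Z => IsGorensteinProjective Z ∨ ∃ Y, IsGorensteinProjective Y ∧ Z = (Y ⊞ Q : C)) ?_ ?_
    (.inr ⟨X, h, rfl⟩)
  · rintro _ (h | ⟨Y, h, rfl⟩)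
    · obtain ⟨X, hX, hXY⟩ := h.exists_syzygy
      exact ⟨X, .inl hX, hXY⟩
    · obtain ⟨X, hX, hXY⟩ := h.exists_syzygy
      exact ⟨X, .inl hX, hXY.biprod_right Q hQ⟩
  · rintro _ (h | ⟨X, h, rfl⟩)
    · obtain ⟨Y, hY, hXY⟩ := h.exists_cosyzygy
      exact ⟨Y, .inl hY, hXY⟩
    · obtain ⟨Y, hY, hXY⟩ := h.exists_cosyzygy
      exact ⟨Y, .inl hY, hXY.biprod_left Q hQ⟩

end IsGorensteinProjective

/-- An object which becomes Gorenstein projective after adding a projective summand. -/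
def IsStablyGorensteinProjective (X : C) : Prop :=
  ∃ Q : C, Projective Q ∧ IsGorensteinProjective (X ⊞ Q)

namespace IsStablyGorensteinProjective

variable {X P Y : C} {i : X ⟶ P} {p : P ⟶ Y} {w : i ≫ p = 0}

lemma left_of_shortExact (hY : IsStablyGorensteinProjective Y)
    (hs : (ShortComplex.mk i p w).ShortExact) (hP : Projective P) :
    IsStablyGorensteinProjective X := by
  obtain ⟨Q, hQ, hYQ⟩ := hY
  obtain ⟨K, hK, P', i', p', w', hP', hs', -⟩ := hYQ.exists_syzygy
  obtain ⟨e⟩ := (hs.biprod_right Q).schanuel hs' inferInstance hP'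
  exact ⟨P', hP', (hK.biprod (P ⊞ Q) inferInstance).of_iso e.symm⟩

lemma right_of_shortExact (hX : IsStablyGorensteinProjective X)
    (hs : (ShortComplex.mk i p w).ShortExact) (hP : Projective P) (he : ExtendsToProjectives i) :
    IsStablyGorensteinProjective Y := by
  obtain ⟨Q, hQ, hXQ⟩ := hX
  obtain ⟨Z, hZ, P', i', p', w', hP', hs', he'⟩ := hXQ.exists_cosyzygy
  obtain ⟨e⟩ := (hs.biprod_left Q).schanuel_of_extendsToProjectives hs' inferInstance hP'
    (he.biprod_map_id Q) he'
  exact ⟨P', hP', (hZ.biprod (P ⊞ Q) inferInstance).of_iso e.symm⟩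

lemma extendsToProjectives (hY : IsStablyGorensteinProjective Y)
    (hs : (ShortComplex.mk i p w).ShortExact) : ExtendsToProjectives i := by
  obtain ⟨Q, hQ, hYQ⟩ := hY
  obtain ⟨K, hK, hKY⟩ := hYQ.exists_syzygy
  exact (hKY.extendsToProjectives (hs.biprod_right Q)).of_comp

lemma exists_epi (hY : IsStablyGorensteinProjective Y) :
    ∃ (P : C) (p : P ⟶ Y), Projective P ∧ Epi p := by
  obtain ⟨Q, hQ, hYQ⟩ := hY
  obtain ⟨K, hK, P, i, p, w, hP, hs, -⟩ := hYQ.exists_syzygy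
  have : Epi p := hs.epi_g
  exact ⟨P, p ≫ biprod.fst, hP, inferInstance⟩

lemma exists_mono (hX : IsStablyGorensteinProjective X) :
    ∃ (P : C) (i : X ⟶ P), Projective P ∧ Mono i ∧ ExtendsToProjectives i := by
  obtain ⟨Q, hQ, hXQ⟩ := hX
  obtain ⟨Z, hZ, P, i, p, w, hP, hs, he⟩ := hXQ.exists_cosyzygy
  have : Mono i := hs.mono_f
  exact ⟨P, biprod.inl ≫ i, hP, inferInstance, (ExtendsToProjectives.of_splitMono _).comp he⟩

end IsStablyGorensteinProjective

end GorensteinProjective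

section FrobeniusPair

variable {C D : Type*} [Category C] [Category D]
  {F : C ⥤ D} {H : D ⥤ C}

lemma ExtendsToProjectives.map_of_adjunction [F.PreservesEpimorphisms] (adj₁ : F ⊣ H)
    (adj₂ : H ⊣ F) {X Z : C} {i : X ⟶ Z} (h : ExtendsToProjectives i) :
    ExtendsToProjectives (F.map i) := by
  intro T hT f
  obtain ⟨g, hg⟩ := h _ (adj₂.map_projective T hT) (adj₁.homEquiv _ _ f)
  refine ⟨(adj₁.homEquiv _ _).symm g, ?_⟩
  rw [← Adjunction.homEquiv_naturality_left_symm, hg, Equiv.symm_apply_apply]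

/-- A faithful functor with a two-sided adjoint reflects extendability along a morphism. -/
lemma ExtendsToProjectives.of_map_of_adjunction [H.PreservesEpimorphisms] [F.Faithful]
    (adj₁ : F ⊣ H) (adj₂ : H ⊣ F) {X Z : C} {i : X ⟶ Z} (h : ExtendsToProjectives (F.map i)) :
    ExtendsToProjectives i := by
  intro T hT f
  have := adj₂.counit_epi_of_R_faithful
  let s : T ⟶ H.obj (F.obj T) := Projective.factorThru (𝟙 T) (adj₂.counit.app T)
  obtain ⟨g, hg⟩ := h _ (adj₁.map_projective T hT) ((adj₁.homEquiv _ _).symm (f ≫ s))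
  refine ⟨adj₁.homEquiv _ _ g ≫ adj₂.counit.app T, ?_⟩
  rw [← Category.assoc, ← adj₁.homEquiv_naturality_left, hg, Equiv.apply_symm_apply,
    Category.assoc, Projective.factorThru_comp, Category.comp_id]

/-- The adjoint transpose of a morphism `F.obj X ⟶ T` extending along projectives has the same
property after applying `F`. -/
lemma ExtendsToProjectives.map_homEquiv (adj₁ : F ⊣ H) {X : C} {T : D} {j : F.obj X ⟶ T}
    (h : ExtendsToProjectives j) : ExtendsToProjectives (F.map (adj₁.homEquiv _ _ j)) := by
  refine ExtendsToProjectives.of_comp (j := adj₁.counit.app T) ?_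
  have hj : F.map (adj₁.homEquiv _ _ j) ≫ adj₁.counit.app T = j := by
    simp [adj₁.homEquiv_unit]
  rwa [hj]

section

variable [Abelian C] [Abelian D] [PreservesFiniteLimits F] [PreservesFiniteColimits F]

lemma IsHomExactSyzygy.map_of_adjunction [F.Additive] [H.PreservesEpimorphisms] (adj₁ : F ⊣ H)
    (adj₂ : H ⊣ F) {X Y : C} (h : IsHomExactSyzygy X Y) :
    IsHomExactSyzygy (F.obj X) (F.obj Y) := by
  obtain ⟨P, i, p, w, hP, hs, he⟩ := h
  exact ⟨F.obj P, F.map i, F.map p, by simp [← F.map_comp, w], adj₁.map_projective P hP,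
    hs.map_of_exact F, he.map_of_adjunction adj₁ adj₂⟩

lemma IsGorensteinProjective.map_of_adjunction [F.Additive] [H.PreservesEpimorphisms]
    (adj₁ : F ⊣ H) (adj₂ : H ⊣ F) {X : C} (h : IsGorensteinProjective X) :
    IsGorensteinProjective (F.obj X) := by
  refine isGorensteinProjective_of_class
    (fun Z => ∃ Y, IsGorensteinProjective Y ∧ Z = F.obj Y) ?_ ?_ ⟨X, h, rfl⟩
  · rintro _ ⟨Y, h, rfl⟩
    obtain ⟨X, hX, hXY⟩ := h.exists_syzygy
    exact ⟨_, ⟨X, hX, rfl⟩, hXY.map_of_adjunction adj₁ adj₂⟩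
  · rintro _ ⟨X, h, rfl⟩
    obtain ⟨Y, hY, hXY⟩ := h.exists_cosyzygy
    exact ⟨_, ⟨Y, hY, rfl⟩, hXY.map_of_adjunction adj₁ adj₂⟩

lemma IsGorensteinProjective.of_map_of_adjunction [F.Additive] [F.Faithful]
    [H.PreservesEpimorphisms] [H.PreservesMonomorphisms] (adj₁ : F ⊣ H) (adj₂ : H ⊣ F) {X : C}
    (h : IsGorensteinProjective (F.obj X)) : IsGorensteinProjective X := by
  have (Z : C) : Epi (adj₂.counit.app Z) := adj₂.counit_epi_of_R_faithful Z
  have (Z : C) : Mono (adj₁.unit.app Z) := adj₁.unit_mono_of_L_faithful Z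
  have hF {P : D} (hP : Projective P) : Projective (F.obj (H.obj P)) :=
    adj₁.map_projective _ (adj₂.map_projective _ hP)
  open ZeroObject in
  refine isGorensteinProjective_of_class
    (fun Z => IsStablyGorensteinProjective (F.obj Z)) ?_ ?_
    ⟨0, inferInstance, h.biprod 0 inferInstance⟩
  · intro Y hY
    obtain ⟨P, e, hP, he⟩ := hY.exists_epi
    let p := H.map e ≫ adj₂.counit.app Y
    have hs : (ShortComplex.mk (kernel.ι p) p (kernel.condition p)).ShortExact :=
      ShortComplex.shortExact_of_exists_lift _ fun k hk =>
        ⟨kernel.lift p k hk, kernel.lift_ι _ _ _⟩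
    have hs' := hs.map_of_exact F
    exact ⟨kernel p, hY.left_of_shortExact hs' (hF hP), _, _, _, _,
      adj₂.map_projective P hP, hs,
      (hY.extendsToProjectives hs').of_map_of_adjunction adj₁ adj₂⟩
  · intro X hX
    obtain ⟨P, j, hP, hj, hjP⟩ := hX.exists_mono
    let i := adj₁.homEquiv _ _ j
    have hi : Mono i := by
      dsimp [i]
      rw [adj₁.homEquiv_unit]
      infer_instance
    have hs : (ShortComplex.mk i (cokernel.π i) (cokernel.condition i)).ShortExact :=
      ShortComplex.shortExact_of_exists_desc _ fun k hk =>
        ⟨cokernel.desc i k hk, cokernel.π_desc _ _ _⟩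
    have hiP : ExtendsToProjectives (F.map i) := hjP.map_homEquiv adj₁
    exact ⟨cokernel i, hX.right_of_shortExact (hs.map_of_exact F) (hF hP) hiP, _, _, _, _,
      adj₂.map_projective P hP, hs, hiP.of_map_of_adjunction adj₁ adj₂⟩

end

end FrobeniusPair

/-- Lemma 5.1(1) of the paper. Let `M` be a Frobenius `B`-`A`-bimodule.
Since Mathlib has no tensor product over noncommutative rings, we encode the bimodule `M`
by its tensor functor `F = M ⊗_A -` together with the common two-sided adjoint
`H = N ⊗_B -` (by Morita's theorem on strongly adjoint pairs, Frobenius pairs of additive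
functors between module categories correspond exactly to Frobenius bimodules), and the
condition that `M` is a generator as a right `A`-module by the equivalent condition that
the tensor functor `F = M ⊗_A -` is faithful. The conclusion: `F` sends Gorenstein
projective `A`-modules to Gorenstein projective `B`-modules, and if `M_A` is a generator
the converse holds. -/
theorem frobenius_bimodule_tensor_gorenstein_projective
    {A : Type u₁} [Ring A] {B : Type u₂} [Ring B]
    (F : ModuleCat.{v} A ⥤ ModuleCat.{v} B) (H : ModuleCat.{v} B ⥤ ModuleCat.{v} A)
    [F.Additive] [H.Additive] (adj₁ : F ⊣ H) (adj₂ : H ⊣ F) :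
    (∀ X : ModuleCat.{v} A,
        IsGorensteinProjective X → IsGorensteinProjective (F.obj X)) ∧
      (F.Faithful →
        ∀ X : ModuleCat.{v} A,
          IsGorensteinProjective (F.obj X) → IsGorensteinProjective X) := by
  have := adj₁.leftAdjoint_preservesColimits.{0, 0}
  have := adj₁.rightAdjoint_preservesLimits.{0, 0}
  have := adj₂.leftAdjoint_preservesColimits.{0, 0}
  have := adj₂.rightAdjoint_preservesLimits.{0, 0}
  have : PreservesFiniteLimits F := PreservesLimitsOfSize.preservesFiniteLimits.{0, 0} F
  have : PreservesFiniteColimits F := PreservesColimitsOfSize.preservesFiniteColimits.{0, 0} F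
  have : H.PreservesEpimorphisms := Functor.preservesEpimorphisms_of_adjunction adj₂
  have : H.PreservesMonomorphisms := Functor.preservesMonomorphisms_of_adjunction adj₁
  exact ⟨fun X h => h.map_of_adjunction adj₁ adj₂,
    fun _ X h => h.of_map_of_adjunction adj₁ adj₂⟩
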